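/- arXiv:0803.4257 — 2 statements merged into one kernel-verified Lean document; each statement's English description precedes it below -/
import Mathlib

section
/- For $N_c = 2$ colours and $N_f = 2$ flavours, the Molien integral $\frac{1}{2}\cdot\frac{1}{2\pi i}\oint_{|z|=1} \frac{dz}{z}\,(1-z^2)(1-z^{-2})\prod_{l=1}^{4}(1-t_l z)^{-1}(1-t_l z^{-1})^{-1}$ equals $\frac{1-t_1 t_2 t_3 t_4}{(1-t_1 t_2)(1-t_1 t_3)(1-t_1 t_4)(1-t_2 t_3)(1-t_2 t_4)(1-t_3 t_4)}$, for complex parameters with $0 < |t_l| < 1$ for all $l$. -/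
open Complex

/-- Invariance of `dz / z` on the unit circle under inversion. -/
theorem molien_circle_inv (f : ℂ → ℂ) :
    (∮ z in C(0, 1), z⁻¹ * f z⁻¹) = ∮ z in C(0, 1), z⁻¹ * f z := by
  have key : ∀ g : ℂ → ℂ, (∮ z in C(0, 1), z⁻¹ * g z)
      = ∫ θ in (0 : ℝ)..2 * Real.pi, I * g (circleMap 0 1 θ) := by
    intro g
    unfold circleIntegral
    congr 1
    ext θ
    have h0 : circleMap 0 1 θ ≠ 0 := circleMap_ne_center one_ne_zero
    rw [deriv_circleMap, smul_eq_mul]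
    field_simp
  rw [key f, key (fun z => f z⁻¹)]
  have h := intervalIntegral.integral_comp_sub_left (a := 0) (b := 2 * Real.pi)
    (fun θ : ℝ => I * f (circleMap 0 1 θ)) (2 * Real.pi)
  rw [sub_self, sub_zero] at h
  rw [← h]
  congr 1
  ext θ
  have : circleMap 0 1 (2 * Real.pi - θ) = (circleMap 0 1 θ)⁻¹ := by
    simp only [circleMap, zero_add, ofReal_one, one_mul]
    rw [← Complex.exp_neg]
    push_cast
    rw [sub_mul, Complex.exp_sub, Complex.exp_two_pi_mul_I, Complex.exp_neg, one_div]
  rw [this]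

theorem molien_one_sub_ne {a b : ℂ} (ha : ‖a‖ < 1) (hb : ‖b‖ ≤ 1) : 1 - a * b ≠ 0 := by
  intro h
  have h1 : a * b = 1 := (sub_eq_zero.mp h).symm
  have h2 : ‖a‖ * ‖b‖ = 1 := by rw [← norm_mul, h1, norm_one]
  nlinarith [norm_nonneg a, norm_nonneg b]

/-- The regular half of the integrand. -/
noncomputable def molienHalf (t₁ t₂ t₃ t₄ z : ℂ) : ℂ :=
  ((1 - t₁ * t₂ * t₃ * t₄)
    + ((t₁ + t₂ + t₃ + t₄) * (t₁ * t₂ * t₃ * t₄)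
        - (t₁ * t₂ * t₃ + t₁ * t₂ * t₄ + t₁ * t₃ * t₄ + t₂ * t₃ * t₄)) * (z - z ^ 3)
    - (1 - t₁ * t₂ * t₃ * t₄) ^ 2 * z ^ 2
    - (t₁ * t₂ * t₃ * t₄) * (1 - t₁ * t₂ * t₃ * t₄) * z ^ 4) /
  (((1 - t₁ * z) * (1 - t₂ * z) * (1 - t₃ * z) * (1 - t₄ * z)) *
    ((1 - t₁ * t₂) * (1 - t₁ * t₃) * (1 - t₁ * t₄) *
         (1 - t₂ * t₃) * (1 - t₂ * t₄) * (1 - t₃ * t₄)))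

/-- The Molien integral for `SU(2)` SQCD with two flavours (four chemical potentials). -/
theorem molien_su2_two_flavours (t₁ t₂ t₃ t₄ : ℂ)
    (h₁ : 0 < ‖t₁‖) (h₁' : ‖t₁‖ < 1) (h₂ : 0 < ‖t₂‖) (h₂' : ‖t₂‖ < 1)
    (h₃ : 0 < ‖t₃‖) (h₃' : ‖t₃‖ < 1) (h₄ : 0 < ‖t₄‖) (h₄' : ‖t₄‖ < 1) :
    (1 / 2) * (1 / (2 * Real.pi * I)) *
      (∮ z in C(0, 1), z⁻¹ * ((1 - z ^ 2) * (1 - z⁻¹ ^ 2)) *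
        ((1 - t₁ * z)⁻¹ * (1 - t₁ * z⁻¹)⁻¹ * (1 - t₂ * z)⁻¹ * (1 - t₂ * z⁻¹)⁻¹ *
         (1 - t₃ * z)⁻¹ * (1 - t₃ * z⁻¹)⁻¹ * (1 - t₄ * z)⁻¹ * (1 - t₄ * z⁻¹)⁻¹))
    = (1 - t₁ * t₂ * t₃ * t₄) /
        ((1 - t₁ * t₂) * (1 - t₁ * t₃) * (1 - t₁ * t₄) *
         (1 - t₂ * t₃) * (1 - t₂ * t₄) * (1 - t₃ * t₄)) := by
  have d12 := molien_one_sub_ne h₁' h₂'.le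
  have d13 := molien_one_sub_ne h₁' h₃'.le
  have d14 := molien_one_sub_ne h₁' h₄'.le
  have d23 := molien_one_sub_ne h₂' h₃'.le
  have d24 := molien_one_sub_ne h₂' h₄'.le
  have d34 := molien_one_sub_ne h₃' h₄'.le
  have hdiff : DifferentiableOn ℂ (molienHalf t₁ t₂ t₃ t₄) (Metric.closedBall 0 1) := by
    intro z hz
    have hz' : ‖z‖ ≤ 1 := by simpa using hz
    have b1 := molien_one_sub_ne h₁' hz'
    have b2 := molien_one_sub_ne h₂' hz'
    have b3 := molien_one_sub_ne h₃' hz'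
    have b4 := molien_one_sub_ne h₄' hz'
    apply DifferentiableAt.differentiableWithinAt
    unfold molienHalf
    refine DifferentiableAt.div (by fun_prop) (by fun_prop) ?_
    simp only [ne_eq, mul_eq_zero, not_or]
    tauto
  have hc := hdiff.circleIntegral_sub_inv_smul (w := 0) (by simp)
  simp only [sub_zero, smul_eq_mul] at hc
  have hcont := hdiff.continuousOn
  have hi1 : CircleIntegrable (fun z => z⁻¹ * molienHalf t₁ t₂ t₃ t₄ z) 0 1 := by
    apply ContinuousOn.circleIntegrable zero_le_one
    refine ContinuousOn.mul (continuousOn_id.inv₀ ?_)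
      (hcont.mono Metric.sphere_subset_closedBall)
    intro z hz h0
    simp_all
  have hi2 : CircleIntegrable (fun z => z⁻¹ * molienHalf t₁ t₂ t₃ t₄ z⁻¹) 0 1 := by
    apply ContinuousOn.circleIntegrable zero_le_one
    have hinv : ContinuousOn (fun z : ℂ => z⁻¹) (Metric.sphere 0 1) := by
      refine continuousOn_id.inv₀ ?_
      intro z hz h0
      simp_all
    refine hinv.mul (hcont.comp hinv ?_)
    intro z hz
    simp_all
  have hsplit : (∮ z in C(0, 1), z⁻¹ * ((1 - z ^ 2) * (1 - z⁻¹ ^ 2)) *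
        ((1 - t₁ * z)⁻¹ * (1 - t₁ * z⁻¹)⁻¹ * (1 - t₂ * z)⁻¹ * (1 - t₂ * z⁻¹)⁻¹ *
         (1 - t₃ * z)⁻¹ * (1 - t₃ * z⁻¹)⁻¹ * (1 - t₄ * z)⁻¹ * (1 - t₄ * z⁻¹)⁻¹))
      = ∮ z in C(0, 1), (z⁻¹ * molienHalf t₁ t₂ t₃ t₄ z
          + z⁻¹ * molienHalf t₁ t₂ t₃ t₄ z⁻¹) := by
    refine circleIntegral.integral_congr zero_le_one ?_
    intro z hz
    have hz1 : ‖z‖ = 1 := by simpa using hz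
    have hz0 : z ≠ 0 := by
      intro h
      simp [h] at hz1
    have hw : z * z⁻¹ = 1 := mul_inv_cancel₀ hz0
    have hw1 : ‖z⁻¹‖ ≤ 1 := by rw [norm_inv, hz1, inv_one]
    have b1 := molien_one_sub_ne h₁' hz1.le
    have b2 := molien_one_sub_ne h₂' hz1.le
    have b3 := molien_one_sub_ne h₃' hz1.le
    have b4 := molien_one_sub_ne h₄' hz1.le
    have a1 := molien_one_sub_ne h₁' hw1
    have a2 := molien_one_sub_ne h₂' hw1
    have a3 := molien_one_sub_ne h₃' hw1
    have a4 := molien_one_sub_ne h₄' hw1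
    have c : ∀ t : ℂ, 1 - t * z⁻¹ ≠ 0 → z - t ≠ 0 := by
      intro t ht h
      apply ht
      rw [← sub_eq_zero.mp h, hw, sub_self]
    have e : ∀ t : ℂ, 1 - t * z⁻¹ = (z - t) / z := by
      intro t
      field_simp
    have c1 := c _ a1
    have c2 := c _ a2
    have c3 := c _ a3
    have c4 := c _ a4
    have ew : ∀ t : ℂ, (1 - t * z⁻¹)⁻¹ = z * (z - t)⁻¹ := by
      intro t
      rw [e, inv_div, div_eq_mul_inv]
    have hnum : ∀ u v q r : ℂ, u + v * (z⁻¹ - z⁻¹ ^ 3) - q * z⁻¹ ^ 2 - r * z⁻¹ ^ 4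
        = (u * z ^ 4 + v * (z ^ 3 - z) - q * z ^ 2 - r) / z ^ 4 := by
      intro u v q r
      field_simp
    have hden : (z - t₁) / z * ((z - t₂) / z) * ((z - t₃) / z) * ((z - t₄) / z)
        = ((z - t₁) * (z - t₂) * (z - t₃) * (z - t₄)) / z ^ 4 := by
      field_simp
    have hgen : ∀ A B D H K : ℂ, A ≠ 0 → B ≠ 0 → D ≠ 0 →
        H * A + K * B = -z ^ 2 * (1 - z ^ 2) ^ 2 * D →
        z⁻¹ * ((1 - z ^ 2) * (1 - z⁻¹ ^ 2)) * (z ^ 4 * A⁻¹ * B⁻¹)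
          = z⁻¹ * (H / (B * D)) + z⁻¹ * (K / z ^ 4 / (A / z ^ 4 * D)) := by
      intro A B D H K hA hB hD h
      have h2 : z⁻¹ * (H / (B * D)) + z⁻¹ * (K / z ^ 4 / (A / z ^ 4 * D))
          = z⁻¹ * ((H * A + K * B) / (A * B * D)) := by
        field_simp
      rw [h2, h]
      field_simp
      ring
    have hL : z⁻¹ * ((1 - z ^ 2) * (1 - z⁻¹ ^ 2)) *
        ((1 - t₁ * z)⁻¹ * (1 - t₁ * z⁻¹)⁻¹ * (1 - t₂ * z)⁻¹ * (1 - t₂ * z⁻¹)⁻¹ *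
         (1 - t₃ * z)⁻¹ * (1 - t₃ * z⁻¹)⁻¹ * (1 - t₄ * z)⁻¹ * (1 - t₄ * z⁻¹)⁻¹)
      = z⁻¹ * ((1 - z ^ 2) * (1 - z⁻¹ ^ 2)) *
        (z ^ 4 * ((z - t₁) * (z - t₂) * (z - t₃) * (z - t₄))⁻¹ *
          ((1 - t₁ * z) * (1 - t₂ * z) * (1 - t₃ * z) * (1 - t₄ * z))⁻¹) := by
      simp only [ew, mul_inv]
      ring
    simp only [hL]
    rw [molienHalf, molienHalf, hnum, e, e, e, e, hden]
    apply hgen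
    · exact mul_ne_zero (mul_ne_zero (mul_ne_zero c1 c2) c3) c4
    · exact mul_ne_zero (mul_ne_zero (mul_ne_zero b1 b2) b3) b4
    · exact mul_ne_zero (mul_ne_zero (mul_ne_zero (mul_ne_zero (mul_ne_zero d12 d13) d14) d23)
        d24) d34
    · ring
  rw [hsplit, circleIntegral.integral_add hi1 hi2, molien_circle_inv, hc]
  have hpi : (Real.pi : ℂ) ≠ 0 := by exact_mod_cast Real.pi_ne_zero
  have hI := I_ne_zero
  unfold molienHalf
  simp only [mul_zero, sub_zero, one_mul, ne_eq, OfNat.ofNat_ne_zero, not_false_eq_true, zero_pow,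
    add_zero]
  field_simp
  try ring
end

section
/- For $SU(3)$ SQCD with one flavour, the refined generating function equals $\frac{1}{1 - t_1\tilde{t}_1}$; i.e., the Molien--Weyl double contour integral over the maximal torus of $SU(3)$ of the plethystic exponential of one fundamental and one antifundamental character evaluates to $\frac{1}{1-t_1\tilde{t}_1}$, for $0 < |t_1|, |\tilde{t}_1| < 1$. -/
open Complex

lemma circ_hasSum {ι : Type} [Countable ι] (f : ι → ℂ → ℂ) (g : ℂ → ℂ) (b : ι → ℝ)
    (hb : Summable b) (hc : ∀ i, ContinuousOn (f i) (Metric.sphere 0 1))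
    (hle : ∀ i, ∀ z ∈ Metric.sphere (0:ℂ) 1, ‖f i z‖ ≤ b i)
    (hs : ∀ z ∈ Metric.sphere (0:ℂ) 1, HasSum (fun i => f i z) (g z)) :
    ContinuousOn g (Metric.sphere 0 1) ∧
      HasSum (fun i => ∮ z in C(0, 1), f i z) (∮ z in C(0, 1), g z) := by
  constructor
  · refine (continuousOn_tsum hc hb hle).congr ?_
    intro z hz
    exact (hs z hz).tsum_eq.symm
  · unfold circleIntegral
    refine intervalIntegral.hasSum_integral_of_dominated_convergence (fun i _ => b i) ?_ ?_ ?_ ?_ ?_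
    · intro i
      have := (hc i).circleIntegrable zero_le_one
      exact (intervalIntegrable_iff.1 this.out).aestronglyMeasurable
    · intro i
      refine Filter.Eventually.of_forall fun θ _ => ?_
      have := hle i (circleMap 0 1 θ) (circleMap_mem_sphere 0 zero_le_one θ)
      simpa [norm_smul, deriv_circleMap] using this
    · exact Filter.Eventually.of_forall fun θ _ => hb
    · exact intervalIntegrable_const
    · refine Filter.Eventually.of_forall fun θ _ => ?_
      exact (hs (circleMap 0 1 θ) (circleMap_mem_sphere 0 zero_le_one θ)).const_smul _

lemma circ_mono (n : ℤ) (c : ℂ) :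
    (∮ z in C(0, 1), c * z ^ (n - 1)) = if n = 0 then c * (2 * Real.pi * I) else 0 := by
  rw [circleIntegral.integral_const_mul]
  split_ifs with h
  · subst h
    have := circleIntegral.integral_sub_center_inv (0:ℂ) (R := 1) one_ne_zero
    simp at this
    simp [this]
  · have := circleIntegral.integral_sub_zpow_of_ne (n := n - 1) (by omega) (0:ℂ) 0 1
    simp at this
    simp [this]

def IsAvg (F : ℂ → ℂ → ℂ) (c : ℂ) : Prop :=
  (∀ z ∈ Metric.sphere (0:ℂ) 1, ContinuousOn (F z) (Metric.sphere 0 1)) ∧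
  ContinuousOn (fun z => ∮ w in C(0, 1), F z w) (Metric.sphere 0 1) ∧
  (∮ z in C(0, 1), ∮ w in C(0, 1), F z w) = (2 * Real.pi * I) ^ 2 * c

lemma IsAvg.congr {F G : ℂ → ℂ → ℂ} {c : ℂ} (h : IsAvg F c)
    (hFG : ∀ z ∈ Metric.sphere (0:ℂ) 1, ∀ w ∈ Metric.sphere (0:ℂ) 1, G z w = F z w) :
    IsAvg G c := by
  obtain ⟨h1, h2, h3⟩ := h
  have key : ∀ z ∈ Metric.sphere (0:ℂ) 1,
      (∮ w in C(0, 1), G z w) = ∮ w in C(0, 1), F z w := fun z hz =>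
    circleIntegral.integral_congr zero_le_one (fun w hw => hFG z hz w hw)
  refine ⟨fun z hz => (h1 z hz).congr (fun w hw => hFG z hz w hw), h2.congr key, ?_⟩
  rw [← h3]
  exact circleIntegral.integral_congr zero_le_one key

lemma IsAvg.add {F G : ℂ → ℂ → ℂ} {c d : ℂ} (h : IsAvg F c) (h' : IsAvg G d) :
    IsAvg (fun z w => F z w + G z w) (c + d) := by
  obtain ⟨h1, h2, h3⟩ := h
  obtain ⟨h1', h2', h3'⟩ := h'
  have key : ∀ z ∈ Metric.sphere (0:ℂ) 1,
      (∮ w in C(0, 1), (F z w + G z w)) = (∮ w in C(0, 1), F z w) + ∮ w in C(0, 1), G z w :=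
    fun z hz => circleIntegral.integral_add ((h1 z hz).circleIntegrable zero_le_one)
      ((h1' z hz).circleIntegrable zero_le_one)
  refine ⟨fun z hz => (h1 z hz).add (h1' z hz), (h2.add h2').congr key, ?_⟩
  rw [circleIntegral.integral_congr zero_le_one key, circleIntegral.integral_add
    (h2.circleIntegrable zero_le_one) (h2'.circleIntegrable zero_le_one), h3, h3']
  ring

lemma IsAvg.sub {F G : ℂ → ℂ → ℂ} {c d : ℂ} (h : IsAvg F c) (h' : IsAvg G d) :
    IsAvg (fun z w => F z w - G z w) (c - d) := by
  obtain ⟨h1, h2, h3⟩ := h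
  obtain ⟨h1', h2', h3'⟩ := h'
  have key : ∀ z ∈ Metric.sphere (0:ℂ) 1,
      (∮ w in C(0, 1), (F z w - G z w)) = (∮ w in C(0, 1), F z w) - ∮ w in C(0, 1), G z w :=
    fun z hz => circleIntegral.integral_sub ((h1 z hz).circleIntegrable zero_le_one)
      ((h1' z hz).circleIntegrable zero_le_one)
  refine ⟨fun z hz => (h1 z hz).sub (h1' z hz), (h2.sub h2').congr key, ?_⟩
  rw [circleIntegral.integral_congr zero_le_one key, circleIntegral.integral_sub
    (h2.circleIntegrable zero_le_one) (h2'.circleIntegrable zero_le_one), h3, h3']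
  ring

lemma cont_zpow (n : ℤ) (c : ℂ) : ContinuousOn (fun z : ℂ => c * z ^ n) (Metric.sphere 0 1) := by
  refine continuousOn_const.mul (continuousOn_id.zpow₀ n ?_)
  intro z hz
  left
  rintro h
  simp at h
  simp [h] at hz

noncomputable def Tm (s t : ℂ) (p q i j k l : ℤ) (z w : ℂ) : ℂ :=
  z ^ (p - 1) * w ^ (q - 1) * ((1 - s * (z ^ i * w ^ j))⁻¹ * (1 - t * (z ^ k * w ^ l))⁻¹)

lemma avg_T (s t : ℂ) (hs : ‖s‖ < 1) (ht : ‖t‖ < 1) (p q i j k l : ℤ) (c : ℂ)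
    (hc : HasSum (fun x : ℕ × ℕ => if p + x.1 * i + x.2 * k = 0 ∧ q + x.1 * j + x.2 * l = 0 then
      s ^ x.1 * t ^ x.2 else 0) c) :
    IsAvg (Tm s t p q i j k l) c := by
  have hb : Summable (fun x : ℕ × ℕ => ‖s‖ ^ x.1 * ‖t‖ ^ x.2) :=
    (summable_geometric_of_lt_one (norm_nonneg s) hs).mul_of_nonneg
      (summable_geometric_of_lt_one (norm_nonneg t) ht) (fun _ => by positivity)
      (fun _ => by positivity)
  have inner : ∀ z ∈ Metric.sphere (0:ℂ) 1, _ := fun z hz => circ_hasSum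
    (fun (x : ℕ × ℕ) w => (s ^ x.1 * t ^ x.2 * z ^ (p + x.1 * i + x.2 * k - 1)) *
      w ^ (q + x.1 * j + x.2 * l - 1)) (Tm s t p q i j k l z) _ hb
    (fun x => cont_zpow _ _)
    (by
      intro x w hw
      simp only [mem_sphere_iff_norm, sub_zero] at hz hw
      simp [hz, hw])
    (by
      intro w hw
      simp only [mem_sphere_iff_norm, sub_zero] at hz hw
      have hz0 : z ≠ 0 := by rintro rfl; simp at hz
      have hw0 : w ≠ 0 := by rintro rfl; simp at hw
      have n1 : ‖s * (z ^ i * w ^ j)‖ < 1 := by simpa [hz, hw] using hs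
      have n2 : ‖t * (z ^ k * w ^ l)‖ < 1 := by simpa [hz, hw] using ht
      have g := (hasSum_geometric_of_norm_lt_one n1).mul (hasSum_geometric_of_norm_lt_one n2)
        (summable_mul_of_summable_norm (summable_norm_geometric_of_norm_lt_one n1)
          (summable_norm_geometric_of_norm_lt_one n2))
      refine (g.mul_left (z ^ (p - 1) * w ^ (q - 1))).congr_fun ?_
      intro x
      have e1 : z ^ (p + x.1 * i + x.2 * k - 1) = z ^ (p - 1) * (z ^ i) ^ x.1 * (z ^ k) ^ x.2 := by
        rw [← zpow_natCast, ← zpow_natCast, ← zpow_mul, ← zpow_mul, ← zpow_add₀ hz0,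
          ← zpow_add₀ hz0]
        congr 1; ring
      have e2 : w ^ (q + x.1 * j + x.2 * l - 1) = w ^ (q - 1) * (w ^ j) ^ x.1 * (w ^ l) ^ x.2 := by
        rw [← zpow_natCast, ← zpow_natCast, ← zpow_mul, ← zpow_mul, ← zpow_add₀ hw0,
          ← zpow_add₀ hw0]
        congr 1; ring
      rw [e1, e2]
      ring)
  have outer := circ_hasSum
    (fun (x : ℕ × ℕ) z => (if q + x.1 * j + x.2 * l = 0 then
      s ^ x.1 * t ^ x.2 * (2 * Real.pi * I) else 0) * z ^ (p + x.1 * i + x.2 * k - 1))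
    (fun z => ∮ w in C(0, 1), Tm s t p q i j k l z w) _ (hb.mul_right (2 * Real.pi))
    (fun x => cont_zpow _ _)
    (by
      intro x z hz
      simp only [mem_sphere_iff_norm, sub_zero] at hz
      split_ifs
      · simp [hz, abs_of_pos Real.pi_pos]
      · simp; positivity)
    (by
      intro z hz
      refine (inner z hz).2.congr_fun ?_
      intro x
      rw [circ_mono]
      split_ifs <;> ring)
  refine ⟨fun z hz => (inner z hz).1, outer.1, ?_⟩
  refine outer.2.unique ?_
  refine (hc.mul_left ((2 * Real.pi * I) ^ 2)).congr_fun ?_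
  intro x
  rw [circ_mono]
  split_ifs <;> first | ring1 | (exfalso; tauto)

lemma avg_zero (s t : ℂ) (hs : ‖s‖ < 1) (ht : ‖t‖ < 1) (p q i j k l : ℤ)
    (h : ∀ n m : ℕ, ¬ (p + n * i + m * k = 0 ∧ q + n * j + m * l = 0)) :
    IsAvg (Tm s t p q i j k l) 0 := by
  apply avg_T s t hs ht
  simp only [h, if_false]
  exact hasSum_zero

lemma avg_diag (s t : ℂ) (hs : ‖s‖ < 1) (ht : ‖t‖ < 1) (p q i j k l : ℤ)
    (h : ∀ n m : ℕ, (p + n * i + m * k = 0 ∧ q + n * j + m * l = 0) ↔ n = m) :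
    IsAvg (Tm s t p q i j k l) (1 - t * s)⁻¹ := by
  apply avg_T s t hs ht
  simp only [h]
  have hinj : Function.Injective (fun n : ℕ => (n, n)) := fun a b hab => (Prod.ext_iff.1 hab).1
  refine (hinj.hasSum_iff ?_).1 ?_
  · rintro ⟨n, m⟩ hx
    rw [if_neg]
    rintro h'
    simp only at h'
    exact hx ⟨n, by simp [h']⟩
  · have hn : ‖t * s‖ < 1 := by
      rw [norm_mul]
      exact mul_lt_one_of_nonneg_of_lt_one_left (norm_nonneg _) ht hs.le
    refine (hasSum_geometric_of_norm_lt_one hn).congr_fun ?_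
    intro n
    simp [mul_pow, mul_comm]

lemma avg_quad (s t : ℂ) (a1 a2 b1 b2 c1 c2 d1 d2 e1 e2 f1 f2 : ℤ) (x y u v : ℂ)
    (h1 : IsAvg (Tm s t (2*a1+b1-2*d1-e1) (2*a2+b2-2*d2-e2) a1 a2 (-d1) (-d2)) x)
    (h2 : IsAvg (Tm s t (2*a1+b1-2*d1-f1) (2*a2+b2-2*d2-f2) a1 a2 (-d1) (-d2)) y)
    (h3 : IsAvg (Tm s t (2*a1+c1-2*d1-e1) (2*a2+c2-2*d2-e2) a1 a2 (-d1) (-d2)) u)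
    (h4 : IsAvg (Tm s t (2*a1+c1-2*d1-f1) (2*a2+c2-2*d2-f2) a1 a2 (-d1) (-d2)) v) :
    IsAvg (fun z w => z⁻¹ * w⁻¹ *
      (((z ^ a1 * w ^ a2) ^ 2 * (z ^ b1 * w ^ b2 - z ^ c1 * w ^ c2)
        * (1 - s * (z ^ a1 * w ^ a2))⁻¹) *
       ((z ^ d1 * w ^ d2)⁻¹ ^ 2 * ((z ^ e1 * w ^ e2)⁻¹ - (z ^ f1 * w ^ f2)⁻¹)
        * (1 - t * (z ^ d1 * w ^ d2)⁻¹)⁻¹))) (x - y - (u - v)) := by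
  refine ((h1.sub h2).sub (h3.sub h4)).congr ?_
  intro z hz w hw
  simp only [mem_sphere_iff_norm, sub_zero] at hz hw
  have hz0 : z ≠ 0 := by rintro rfl; simp at hz
  have hw0 : w ≠ 0 := by rintro rfl; simp at hw
  have e : ∀ r : ℂ, r ≠ 0 → ∀ a b c d : ℤ,
      r ^ (2*a+b-2*c-d-1) = r⁻¹ * ((r ^ a) ^ 2 * r ^ b * ((r ^ c)⁻¹ ^ 2 * (r ^ d)⁻¹)) := by
    intro r hr a b c d
    rw [zpow_sub₀ hr, zpow_sub₀ hr, zpow_sub₀ hr, zpow_add₀ hr, mul_comm 2 a, mul_comm 2 c,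
      zpow_mul, zpow_mul, zpow_ofNat, zpow_ofNat, zpow_one]
    simp only [div_eq_mul_inv, inv_pow]
    ring
  simp only [Tm, e z hz0, e w hw0, zpow_neg]
  ring

lemma alg (s a b c : ℂ) (ha : 1 - s * a ≠ 0) (hb : 1 - s * b ≠ 0) (hc : 1 - s * c ≠ 0) :
    (a - b) * (a - c) * (b - c) * ((1 - s * a) * (1 - s * b) * (1 - s * c))⁻¹ =
      a ^ 2 * (b - c) * (1 - s * a)⁻¹ + b ^ 2 * (c - a) * (1 - s * b)⁻¹
        + c ^ 2 * (a - b) * (1 - s * c)⁻¹ := by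
  simp only [← div_eq_mul_inv]
  rw [div_add_div _ _ ha hb, div_add_div _ _ (mul_ne_zero ha hb) hc]
  congr 1
  ring

/-- The Molien–Weyl double contour integral over the maximal torus of `SU(3)` of the
plethystic exponential of one fundamental and one antifundamental character, with
`φ₁ = z₁`, `φ₂ = z₂/z₁`, `φ₃ = 1/z₂`, evaluates to `1/(1 - t₁ s₁)`. -/
theorem molien_weyl_su3_one_flavour (t₁ s₁ : ℂ)
    (h₁ : 0 < ‖t₁‖) (h₁' : ‖t₁‖ < 1) (h₂ : 0 < ‖s₁‖) (h₂' : ‖s₁‖ < 1) :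
    (1 / (6 * (2 * Real.pi * I) ^ 2)) *
      (∮ z₁ in C(0, 1), z₁⁻¹ *
        ∮ z₂ in C(0, 1), z₂⁻¹ *
          ((z₁ - z₂ / z₁) * (z₁ - z₂⁻¹) * (z₂ / z₁ - z₂⁻¹)) *
          ((z₁⁻¹ - z₁ / z₂) * (z₁⁻¹ - z₂) * (z₁ / z₂ - z₂)) *
          ((1 - s₁ * z₁) * (1 - s₁ * z₂ / z₁) * (1 - s₁ / z₂) *
           (1 - t₁ / z₁) * (1 - t₁ * z₁ / z₂) * (1 - t₁ * z₂))⁻¹)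
    = 1 / (1 - t₁ * s₁) := by
  have off := avg_zero s₁ t₁ h₂' h₁'
  have dia := avg_diag s₁ t₁ h₂' h₁'
  have q11 := avg_quad s₁ t₁ 1 0 (-1) 1 0 (-1) 1 0 (-1) 1 0 (-1) _ _ _ _
    (dia _ _ _ _ _ _ (by omega)) (off _ _ _ _ _ _ (by omega))
    (off _ _ _ _ _ _ (by omega)) (dia _ _ _ _ _ _ (by omega))
  have q22 := avg_quad s₁ t₁ (-1) 1 0 (-1) 1 0 (-1) 1 0 (-1) 1 0 _ _ _ _
    (dia _ _ _ _ _ _ (by omega)) (off _ _ _ _ _ _ (by omega))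
    (off _ _ _ _ _ _ (by omega)) (dia _ _ _ _ _ _ (by omega))
  have q33 := avg_quad s₁ t₁ 0 (-1) 1 0 (-1) 1 0 (-1) 1 0 (-1) 1 _ _ _ _
    (dia _ _ _ _ _ _ (by omega)) (off _ _ _ _ _ _ (by omega))
    (off _ _ _ _ _ _ (by omega)) (dia _ _ _ _ _ _ (by omega))
  have q12 := avg_quad s₁ t₁ 1 0 (-1) 1 0 (-1) (-1) 1 0 (-1) 1 0 _ _ _ _
    (off _ _ _ _ _ _ (by omega)) (off _ _ _ _ _ _ (by omega))
    (off _ _ _ _ _ _ (by omega)) (off _ _ _ _ _ _ (by omega))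
  have q13 := avg_quad s₁ t₁ 1 0 (-1) 1 0 (-1) 0 (-1) 1 0 (-1) 1 _ _ _ _
    (off _ _ _ _ _ _ (by omega)) (off _ _ _ _ _ _ (by omega))
    (off _ _ _ _ _ _ (by omega)) (off _ _ _ _ _ _ (by omega))
  have q21 := avg_quad s₁ t₁ (-1) 1 0 (-1) 1 0 1 0 (-1) 1 0 (-1) _ _ _ _
    (off _ _ _ _ _ _ (by omega)) (off _ _ _ _ _ _ (by omega))
    (off _ _ _ _ _ _ (by omega)) (off _ _ _ _ _ _ (by omega))
  have q23 := avg_quad s₁ t₁ (-1) 1 0 (-1) 1 0 0 (-1) 1 0 (-1) 1 _ _ _ _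
    (off _ _ _ _ _ _ (by omega)) (off _ _ _ _ _ _ (by omega))
    (off _ _ _ _ _ _ (by omega)) (off _ _ _ _ _ _ (by omega))
  have q31 := avg_quad s₁ t₁ 0 (-1) 1 0 (-1) 1 1 0 (-1) 1 0 (-1) _ _ _ _
    (off _ _ _ _ _ _ (by omega)) (off _ _ _ _ _ _ (by omega))
    (off _ _ _ _ _ _ (by omega)) (off _ _ _ _ _ _ (by omega))
  have q32 := avg_quad s₁ t₁ 0 (-1) 1 0 (-1) 1 (-1) 1 0 (-1) 1 0 _ _ _ _
    (off _ _ _ _ _ _ (by omega)) (off _ _ _ _ _ _ (by omega))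
    (off _ _ _ _ _ _ (by omega)) (off _ _ _ _ _ _ (by omega))
  have tot := (((q11.add q12).add q13).add ((q21.add q22).add q23)).add ((q31.add q32).add q33)
  have fin : IsAvg (fun z₁ z₂ => z₁⁻¹ * (z₂⁻¹ *
          ((z₁ - z₂ / z₁) * (z₁ - z₂⁻¹) * (z₂ / z₁ - z₂⁻¹)) *
          ((z₁⁻¹ - z₁ / z₂) * (z₁⁻¹ - z₂) * (z₁ / z₂ - z₂)) *
          ((1 - s₁ * z₁) * (1 - s₁ * z₂ / z₁) * (1 - s₁ / z₂) *
           (1 - t₁ / z₁) * (1 - t₁ * z₁ / z₂) * (1 - t₁ * z₂))⁻¹)) (6 * (1 - t₁ * s₁)⁻¹) := by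
    have hv : ∀ F c d, IsAvg F c → c = d → IsAvg F d := fun F c d h e => e ▸ h
    refine (hv _ _ _ tot (by ring)).congr ?_
    clear tot q11 q12 q13 q21 q22 q23 q31 q32 q33
    intro z hz w hw
    simp only [mem_sphere_iff_norm, sub_zero] at hz hw
    have nz : ∀ r x : ℂ, ‖r‖ < 1 → ‖x‖ = 1 → 1 - r * x ≠ 0 := by
      intro r x hr hx h
      have : ‖r * x‖ = 1 := by rw [← sub_eq_zero.1 h]; simp
      rw [norm_mul, hx] at this
      linarith
    have A := alg s₁ z (z⁻¹ * w) w⁻¹ (nz _ _ h₂' hz) (nz _ _ h₂' (by simp [hz, hw]))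
      (nz _ _ h₂' (by simp [hw]))
    have B := alg t₁ z⁻¹ (z * w⁻¹) w (nz _ _ h₁' (by simp [hz])) (nz _ _ h₁' (by simp [hz, hw]))
      (nz _ _ h₁' hw)
    have L : z⁻¹ * (w⁻¹ *
          ((z - w / z) * (z - w⁻¹) * (w / z - w⁻¹)) *
          ((z⁻¹ - z / w) * (z⁻¹ - w) * (z / w - w)) *
          ((1 - s₁ * z) * (1 - s₁ * w / z) * (1 - s₁ / w) *
           (1 - t₁ / z) * (1 - t₁ * z / w) * (1 - t₁ * w))⁻¹) = z⁻¹ * w⁻¹ *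
        (((z - z⁻¹ * w) * (z - w⁻¹) * (z⁻¹ * w - w⁻¹) *
          ((1 - s₁ * z) * (1 - s₁ * (z⁻¹ * w)) * (1 - s₁ * w⁻¹))⁻¹) *
        ((z⁻¹ - z * w⁻¹) * (z⁻¹ - w) * (z * w⁻¹ - w) *
          ((1 - t₁ * z⁻¹) * (1 - t₁ * (z * w⁻¹)) * (1 - t₁ * w))⁻¹)) := by
      have r1 : s₁ * w / z = s₁ * (z⁻¹ * w) := by ring
      have r2 : t₁ * z / w = t₁ * (z * w⁻¹) := by ring
      have r3 : w / z = z⁻¹ * w := by ring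
      rw [r1, r2, r3]
      simp only [div_eq_mul_inv, mul_inv (_ * _) (_ : ℂ), mul_inv (1 - _) (1 - _ : ℂ)]
      ring
    rw [L, A, B]
    simp only [zpow_one, zpow_zero, zpow_neg, mul_one, one_mul, mul_inv, inv_inv]
    ring
  have F := fin.2.2
  simp only [circleIntegral.integral_const_mul] at F
  rw [F]
  have hpi : (2 * Real.pi * I : ℂ) ^ 2 ≠ 0 := pow_ne_zero _ Complex.two_pi_I_ne_zero
  rw [one_div, mul_inv, one_div]
  have : ∀ X P : ℂ, P ≠ 0 → 6⁻¹ * P⁻¹ * (P * (6 * X)) = X := by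
    intro X P hP
    field_simp
  exact this (1 - t₁ * s₁)⁻¹ _ hpi
end
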